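/- Let n ≥ 1, let f : ℝⁿ → ℝ be smooth, fix x₀ ∈ ℝⁿ, R ≥ 2, K ≥ 0, t₀ ∈ ℝ, T > 0, a < 0 and D > 0. Assume ⟨Hess f(x) v, v⟩ ≥ −(n−1)K|v|² for all x in the ball B(x₀,R) and all v ∈ ℝⁿ, and let u be a smooth function on Q_{R,T} = B(x₀,R) × [t₀−T,t₀] with 0 < u ≤ D solving the nonlinear f-heat equation ∂u/∂t = Δ_f u + a·u·ln u. Then there exists a constant c depending only on n such that for all (x,t) ∈ B(x₀,R/2) × (t₀−T, t₀], |∇u|(x,t)/u(x,t) ≤ c·( √((1+|α|)/R) + 1/√(t−t₀+T) + √K + √(c₃) + √(−aκ) )·( 1 + ln(D/u(x,t)) ), where c₃ = max{a + (n−1)K, 0}, κ = max{|ln D|, 1} and α = max_{|x−x₀|=1} ( (n−1) − ⟨∇f(x), x−x₀⟩ ). (This is the Euclidean-space case of the paper's Theorem 1.4(ii).) -/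

import Mathlib

open Metric Set
open scoped RealInnerProductSpace

noncomputable section

/-- Euclidean Laplacian on `EuclideanSpace ℝ (Fin n)`. -/
def eLap {n : ℕ} (u : EuclideanSpace ℝ (Fin n) → ℝ) (x : EuclideanSpace ℝ (Fin n)) : ℝ :=
  ∑ i : Fin n,
    fderiv ℝ (fun y => fderiv ℝ u y (EuclideanSpace.single i 1)) x (EuclideanSpace.single i 1)

/-- Weighted (drift) Laplacian `Δ_f u = Δu − ⟨∇f, ∇u⟩`. -/
def fLap {n : ℕ} (f u : EuclideanSpace ℝ (Fin n) → ℝ) (x : EuclideanSpace ℝ (Fin n)) : ℝ :=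
  eLap u x - ⟪gradient f x, gradient u x⟫

/-- Hessian quadratic form of `f` at `x` evaluated at `(v, v)`. -/
def hessQF {n : ℕ} (f : EuclideanSpace ℝ (Fin n) → ℝ) (x v : EuclideanSpace ℝ (Fin n)) : ℝ :=
  fderiv ℝ (fun y => fderiv ℝ f y v) x v

/-- The constant `α = max_{|x−x₀|=1} ((n−1) − ⟨∇f(x), x−x₀⟩)`. -/
def alphaC {n : ℕ} (f : EuclideanSpace ℝ (Fin n) → ℝ) (x₀ : EuclideanSpace ℝ (Fin n)) : ℝ :=
  sSup ((fun y => (n : ℝ) - 1 - ⟪gradient f y, y - x₀⟫) '' sphere x₀ 1)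

section calculus
variable {V : Type*} [NormedAddCommGroup V] [NormedSpace ℝ V]

/-- Directional derivative. -/
def dd (v : V) (G : V → ℝ) : V → ℝ := fun p => fderiv ℝ G p v

/-- Smoothness on a set. -/
def Sm (Ω : Set V) (G : V → ℝ) : Prop := ContDiffOn ℝ (⊤ : ℕ∞) G Ω

variable {Ω : Set V} {G H : V → ℝ} {p v v' : V}

lemma Sm.diffAt (hG : Sm Ω G) (hΩ : IsOpen Ω) (hp : p ∈ Ω) : DifferentiableAt ℝ G p :=
  (ContDiffOn.contDiffAt hG (hΩ.mem_nhds hp)).differentiableAt (by simp)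

lemma Sm.dd (hG : Sm Ω G) (hΩ : IsOpen Ω) (v : V) : Sm Ω (dd v G) := by
  have h1 : ContDiffOn ℝ (⊤ : ℕ∞) (fderiv ℝ G) Ω :=
    ContDiffOn.fderiv_of_isOpen hG hΩ (by simp)
  exact h1.clm_apply contDiffOn_const

lemma Sm.add (hG : Sm Ω G) (hH : Sm Ω H) : Sm Ω (fun p => G p + H p) := ContDiffOn.add hG hH
lemma Sm.mul (hG : Sm Ω G) (hH : Sm Ω H) : Sm Ω (fun p => G p * H p) := ContDiffOn.mul hG hH
lemma Sm.sum {ι : Type*} [Fintype ι] {G : ι → V → ℝ} (hG : ∀ i, Sm Ω (G i)) :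
    Sm Ω (fun p => ∑ i, G i p) := ContDiffOn.sum (fun i _ => hG i)
lemma Sm.const (c : ℝ) : Sm Ω (fun _ => c) := contDiffOn_const

lemma dd_congr (hΩ : IsOpen Ω) (hp : p ∈ Ω) (h : ∀ q ∈ Ω, G q = H q) : dd v G p = dd v H p := by
  have : G =ᶠ[nhds p] H := Filter.eventually_of_mem (hΩ.mem_nhds hp) h
  simp only [dd, this.fderiv_eq]

lemma dd_add (hΩ : IsOpen Ω) (hp : p ∈ Ω) (hG : Sm Ω G) (hH : Sm Ω H) :
    dd v (fun p => G p + H p) p = dd v G p + dd v H p := by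
  simp only [dd]
  rw [fderiv_fun_add (hG.diffAt hΩ hp) (hH.diffAt hΩ hp)]; rfl

lemma dd_mul (hΩ : IsOpen Ω) (hp : p ∈ Ω) (hG : Sm Ω G) (hH : Sm Ω H) :
    dd v (fun p => G p * H p) p = dd v G p * H p + G p * dd v H p := by
  simp only [dd]
  rw [fderiv_fun_mul (hG.diffAt hΩ hp) (hH.diffAt hΩ hp)]
  simp; ring

lemma dd_const (c : ℝ) : dd v (fun _ => c) p = 0 := by simp [dd]

lemma dd_sum {ι : Type*} [Fintype ι] {G : ι → V → ℝ} (hΩ : IsOpen Ω) (hp : p ∈ Ω)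
    (hG : ∀ i, Sm Ω (G i)) :
    dd v (fun p => ∑ i, G i p) p = ∑ i, dd v (G i) p := by
  simp only [dd]
  rw [fderiv_fun_sum (fun i _ => (hG i).diffAt hΩ hp)]
  simp

lemma dd_comp {φ : ℝ → ℝ} {d : ℝ} (hΩ : IsOpen Ω) (hp : p ∈ Ω) (hG : Sm Ω G)
    (hφ : HasDerivAt φ d (G p)) : dd v (fun p => φ (G p)) p = d * dd v G p := by
  simp only [dd]
  have := hφ.comp_hasFDerivAt p (hG.diffAt hΩ hp).hasFDerivAt
  have h2 : HasFDerivAt (fun p => φ (G p)) (d • fderiv ℝ G p) p := this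
  rw [h2.fderiv]; simp

lemma dd_comm (hΩ : IsOpen Ω) (hp : p ∈ Ω) (hG : Sm Ω G) :
    dd v (dd v' G) p = dd v' (dd v G) p := by
  have h1 : ContDiffAt ℝ (⊤ : ℕ∞) G p := ContDiffOn.contDiffAt hG (hΩ.mem_nhds hp)
  have hs : IsSymmSndFDerivAt ℝ G p := h1.isSymmSndFDerivAt (by
    rw [minSmoothness_of_isRCLikeNormedField]; exact WithTop.coe_le_coe.2 le_top)
  have hd : DifferentiableAt ℝ (fderiv ℝ G) p :=
    (h1.fderiv_right (m := 1) (WithTop.coe_le_coe.2 le_top)).differentiableAt (by simp)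
  have key : ∀ a b : V, dd a (dd b G) p = fderiv ℝ (fderiv ℝ G) p a b := by
    intro a b
    have := (hd.hasFDerivAt.clm_apply (hasFDerivAt_const b p)).fderiv
    show fderiv ℝ (fun y => fderiv ℝ G y b) p a = _
    rw [this]; simp
  rw [key, key]
  exact hs v v'

lemma dd_line (hΩ : IsOpen Ω) {s : ℝ} (hp : p + s • v ∈ Ω) (hG : Sm Ω G) :
    HasDerivAt (fun s : ℝ => G (p + s • v)) (dd v G (p + s • v)) s := by
  have h1 : HasDerivAt (fun s : ℝ => p + s • v) v s := by
    simpa using ((hasDerivAt_id s).smul_const v).const_add p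
  exact (hG.diffAt hΩ hp).hasFDerivAt.comp_hasDerivAt s h1

/-- First and second order conditions at a maximum along a line. -/
lemma max_line (hΩ : IsOpen Ω) (hp : p ∈ Ω) (hG : Sm Ω G)
    (hmax : IsLocalMax (fun s : ℝ => G (p + s • v)) 0) :
    dd v G p = 0 ∧ dd v (dd v G) p ≤ 0 := by
  have hev : ∀ᶠ s : ℝ in nhds 0, p + s • v ∈ Ω := by
    have : ContinuousAt (fun s : ℝ => p + s • v) 0 := by fun_prop
    apply this.eventually_mem
    simpa using hΩ.mem_nhds hp
  have h0 : deriv (fun s : ℝ => G (p + s • v)) 0 = dd v G p := by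
    have := (dd_line (v := v) (s := 0) hΩ (by simpa using hp) hG).deriv
    simpa using this
  have hder : deriv (fun s : ℝ => G (p + s • v)) =ᶠ[nhds 0] fun s => dd v G (p + s • v) := by
    filter_upwards [hev] with s hs
    exact (dd_line hΩ hs hG).deriv
  have h2 : deriv (deriv (fun s : ℝ => G (p + s • v))) 0 = dd v (dd v G) p := by
    rw [hder.deriv_eq]
    have := (dd_line (v := v) (s := 0) hΩ (by simpa using hp) (hG.dd hΩ v)).deriv
    simpa using this
  have hz : deriv (fun s : ℝ => G (p + s • v)) 0 = 0 := hmax.deriv_eq_zero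
  refine ⟨h0 ▸ hz, ?_⟩
  by_contra hcon
  push Not at hcon
  rw [← h2] at hcon
  have hc : ContinuousAt (fun s : ℝ => G (p + s • v)) 0 :=
    (dd_line (v := v) (s := 0) hΩ (by simpa using hp) hG).continuousAt
  have hmin := isLocalMin_of_deriv_deriv_pos hcon hz hc
  have hconst : (fun s : ℝ => G (p + s • v)) =ᶠ[nhds 0] fun _ => G (p + (0:ℝ) • v) := by
    filter_upwards [hmin, hmax] with s h1 h2
    exact le_antisymm h2 h1
  have : deriv (deriv (fun s : ℝ => G (p + s • v))) 0 = 0 := by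
    rw [hconst.deriv.deriv_eq]; simp
  linarith

/-- Bochner-type identity for `w = ∑ (∂ᵢ G)²`. -/
lemma bochner {ι : Type*} [Fintype ι] (hΩ : IsOpen Ω) (e : ι → V) (τ : V) {F : V → ℝ}
    (hG : Sm Ω G) (hF : Sm Ω F) (a b : ℝ) {w : V → ℝ}
    (hw : w = fun p => ∑ j, dd (e j) G p * dd (e j) G p)
    (pde : ∀ q ∈ Ω, dd τ G q = (∑ i, dd (e i) (dd (e i) G) q) + (-1) *
      (∑ i, dd (e i) F q * dd (e i) G q) + (1 + (-1) * Real.exp (G q)) * w q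
        + (a + (-b) * Real.exp (-1 * G q)))
    (hp : p ∈ Ω) :
    (∑ i, dd (e i) (dd (e i) w) p) - (∑ i, dd (e i) F p * dd (e i) w p) - dd τ w p
      = 2 * (∑ i, ∑ j, (dd (e i) (dd (e j) G) p) ^ 2)
        + 2 * (∑ j, ∑ i, dd (e j) (dd (e i) F) p * dd (e i) G p * dd (e j) G p)
        + 2 * (Real.exp (G p) - 1) * (∑ j, dd (e j) G p * dd (e j) w p)
        + 2 * Real.exp (G p) * (w p) ^ 2 - 2 * b * Real.exp (-1 * G p) * w p := by
  have hGi : ∀ i, Sm Ω (dd (e i) G) := fun i => hG.dd hΩ _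
  have hFi : ∀ i, Sm Ω (dd (e i) F) := fun i => hF.dd hΩ _
  have hGij : ∀ v i, Sm Ω (dd v (dd (e i) G)) := fun v i => (hGi i).dd hΩ _
  have hws : Sm Ω w := by rw [hw]; exact Sm.sum fun j => (hGi j).mul (hGi j)
  have hE : Sm Ω (fun q => Real.exp (G q)) := ContDiffOn.exp hG
  have hG1 : Sm Ω (fun q => -1 * G q) := (Sm.const (-1)).mul hG
  have hE' : Sm Ω (fun q => Real.exp (-1 * G q)) := ContDiffOn.exp hG1
  -- first derivatives of w
  have dw : ∀ v, ∀ q ∈ Ω, dd v w q = ∑ j, (2 * dd (e j) G q) * dd v (dd (e j) G) q := by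
    intro v q hq
    rw [hw, dd_sum hΩ hq fun j => (hGi j).mul (hGi j)]
    refine Finset.sum_congr rfl fun j _ => ?_
    rw [dd_mul hΩ hq (hGi j) (hGi j)]; ring
  have ddw : ∀ i, dd (e i) (dd (e i) w) p = ∑ j, (2 * (dd (e i) (dd (e j) G) p) ^ 2 +
      2 * dd (e j) G p * dd (e j) (dd (e i) (dd (e i) G)) p) := by
    intro i
    rw [dd_congr hΩ hp (dw (e i)), dd_sum hΩ hp
      fun j => ((Sm.const 2).mul (hGi j)).mul (hGij _ j)]
    refine Finset.sum_congr rfl fun j _ => ?_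
    rw [dd_mul hΩ hp ((Sm.const 2).mul (hGi j)) (hGij _ j), dd_mul hΩ hp (Sm.const 2) (hGi j),
      dd_const, dd_congr hΩ hp (fun q hq => dd_comm (v := e i) (v' := e j) hΩ hq hG),
      dd_comm hΩ hp (hGi i)]
    rw [dd_comm (v := e i) (v' := e j) hΩ hp hG]
    ring
  -- derivative of the equation
  have dpde : ∀ j, dd τ (dd (e j) G) p = (∑ i, dd (e j) (dd (e i) (dd (e i) G)) p)
      - (∑ i, (dd (e j) (dd (e i) F) p * dd (e i) G p + dd (e i) F p * dd (e i) (dd (e j) G) p))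
      - Real.exp (G p) * dd (e j) G p * w p + (1 - Real.exp (G p)) * dd (e j) w p
      + b * Real.exp (-1 * G p) * dd (e j) G p := by
    intro j
    have s1 : Sm Ω (fun q => ∑ i, dd (e i) (dd (e i) G) q) := Sm.sum fun i => hGij _ i
    have s2 : Sm Ω (fun q => ∑ i, dd (e i) F q * dd (e i) G q) :=
      Sm.sum fun i => (hFi i).mul (hGi i)
    have s3 : Sm Ω (fun q => (-1) * ∑ i, dd (e i) F q * dd (e i) G q) := (Sm.const _).mul s2
    have s4 : Sm Ω (fun q => (-1) * Real.exp (G q)) := (Sm.const _).mul hE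
    have s5 : Sm Ω (fun q => 1 + (-1) * Real.exp (G q)) := (Sm.const _).add s4
    have s6 : Sm Ω (fun q => (-b) * Real.exp (-1 * G q)) := (Sm.const _).mul hE'
    rw [dd_comm hΩ hp hG, dd_congr hΩ hp pde,
      dd_add hΩ hp ((s1.add s3).add (s5.mul hws)) ((Sm.const _).add s6),
      dd_add hΩ hp (s1.add s3) (s5.mul hws), dd_add hΩ hp s1 s3,
      dd_add hΩ hp (Sm.const _) s6, dd_mul hΩ hp s5 hws, dd_add hΩ hp (Sm.const _) s4,
      dd_mul hΩ hp (Sm.const _) hE, dd_mul hΩ hp (Sm.const _) hE', dd_mul hΩ hp (Sm.const _) s2,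
      dd_sum hΩ hp (fun i => hGij _ i), dd_sum hΩ hp (fun i => (hFi i).mul (hGi i)),
      dd_comp hΩ hp hG (Real.hasDerivAt_exp _), dd_comp hΩ hp hG1 (Real.hasDerivAt_exp _),
      dd_mul hΩ hp (Sm.const _) hG]
    simp only [dd_const]
    have : ∀ i, dd (e j) (fun p => dd (e i) F p * dd (e i) G p) p =
        dd (e j) (dd (e i) F) p * dd (e i) G p + dd (e i) F p * dd (e i) (dd (e j) G) p := by
      intro i
      rw [dd_mul hΩ hp (hFi i) (hGi i), dd_comm (v := e j) (v' := e i) hΩ hp hG]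
    simp only [this]
    ring
  rw [dw τ p hp]
  have hwp : w p = ∑ j, dd (e j) G p * dd (e j) G p := by rw [hw]
  have h1 : ∑ i, dd (e i) F p * dd (e i) w p
      = ∑ j, 2 * dd (e j) G p * ∑ i, dd (e i) F p * dd (e i) (dd (e j) G) p := by
    simp only [Finset.mul_sum]
    rw [Finset.sum_comm]
    rw [Finset.sum_comm]
    simp only [dw _ p hp, Finset.mul_sum]
    rw [Finset.sum_comm]
    exact Finset.sum_congr rfl fun j _ => Finset.sum_congr rfl fun i _ => by ring
  have h2 : ∑ i, dd (e i) (dd (e i) w) p = 2 * (∑ i, ∑ j, (dd (e i) (dd (e j) G) p) ^ 2)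
      + ∑ j, 2 * dd (e j) G p * ∑ i, dd (e j) (dd (e i) (dd (e i) G)) p := by
    simp only [ddw, Finset.sum_add_distrib, Finset.mul_sum]
    congr 1
    exact Finset.sum_comm
  have h3 : ∑ j, 2 * dd (e j) G p * dd τ (dd (e j) G) p
      = (∑ j, 2 * dd (e j) G p * ∑ i, dd (e j) (dd (e i) (dd (e i) G)) p)
        - 2 * (∑ j, ∑ i, dd (e j) (dd (e i) F) p * dd (e i) G p * dd (e j) G p)
        - (∑ j, 2 * dd (e j) G p * ∑ i, dd (e i) F p * dd (e i) (dd (e j) G) p)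
        - 2 * Real.exp (G p) * w p * (∑ j, dd (e j) G p * dd (e j) G p)
        + 2 * (1 - Real.exp (G p)) * (∑ j, dd (e j) G p * dd (e j) w p)
        + 2 * b * Real.exp (-1 * G p) * (∑ j, dd (e j) G p * dd (e j) G p) := by
    rw [Finset.mul_sum, Finset.mul_sum, Finset.mul_sum, Finset.mul_sum]
    simp only [← Finset.sum_sub_distrib, ← Finset.sum_add_distrib]
    refine Finset.sum_congr rfl fun j _ => ?_
    rw [dpde j, Finset.sum_add_distrib]
    have : ∑ i, dd (e j) (dd (e i) F) p * dd (e i) G p * dd (e j) G p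
      = dd (e j) G p * ∑ i, dd (e j) (dd (e i) F) p * dd (e i) G p := by
      rw [Finset.mul_sum]; exact Finset.sum_congr rfl fun i _ => by ring
    rw [this]; ring
  rw [h1, h2, h3, ← hwp]
  ring
end calculus

/-- Algebraic step at a positive maximum of `Φ w`. -/
lemma max_alg {ι : Type*} [Fintype ι] (g Φi wi Φii wii Fi : ι → ℝ) (Φ w Φt wt E A B N : ℝ)
    (hΦ : 0 < Φ) (hw : 0 < w) (hE : 1 ≤ E) (hN : 0 ≤ N)
    (hg : ∑ i, g i * g i = w)
    (h1 : ∀ i, Φi i * w + Φ * wi i = 0)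
    (h2 : ∀ i, Φii i * w + 2 * (Φi i * wi i) + Φ * wii i ≤ 0)
    (h3 : 0 ≤ Φt * w + Φ * wt)
    (hboch : -2 * A * w + 2 * (E - 1) * (∑ j, g j * wi j) + 2 * E * w ^ 2
      ≤ (∑ i, wii i) - (∑ i, Fi i * wi i) - wt)
    (hS : ∑ i, Φi i ^ 2 ≤ 4 * B * Φ)
    (hL : -((∑ i, Φii i) - (∑ i, Fi i * Φi i) - Φt) + 2 * A * Φ ≤ N) :
    Φ * w ≤ 4 * B + N := by
  have hwi : ∀ i, wi i = -(w / Φ) * Φi i := by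
    intro i; have := h1 i; field_simp; linarith
  have hk : 0 < w / Φ := by positivity
  have hkw : w / Φ * Φ = w := by field_simp
  set k := w / Φ with hkdef
  set S := ∑ i, Φi i ^ 2 with hSdef
  have e1 : ∑ i, Φi i * wi i = -k * S := by
    rw [hSdef, Finset.mul_sum]; exact Finset.sum_congr rfl fun i _ => by rw [hwi]; ring
  have e2 : ∑ j, g j * wi j = -k * ∑ j, g j * Φi j := by
    rw [Finset.mul_sum]; exact Finset.sum_congr rfl fun i _ => by rw [hwi]; ring
  have e3 : ∑ i, Fi i * wi i = -k * ∑ j, Fi j * Φi j := by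
    rw [Finset.mul_sum]; exact Finset.sum_congr rfl fun i _ => by rw [hwi]; ring
  have e4 : (∑ i, Φii i) * w + 2 * (∑ i, Φi i * wi i) + Φ * ∑ i, wii i ≤ 0 := by
    have := Finset.sum_nonpos (s := Finset.univ) fun i _ => h2 i
    simpa [Finset.sum_add_distrib, Finset.sum_mul, Finset.mul_sum] using this
  have e5 : 2 * Φ * (∑ j, g j * Φi j) ≤ Φ ^ 2 * w + S := by
    rw [← hg, hSdef, Finset.mul_sum, Finset.mul_sum, ← Finset.sum_add_distrib]
    exact Finset.sum_le_sum fun i _ => by nlinarith [sq_nonneg (Φ * g i - Φi i)]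
  set s := ∑ j, g j * Φi j
  set fΦ := ∑ i, Fi i * Φi i
  set lΦ := ∑ i, Φii i
  set lw := ∑ i, wii i
  rw [e2, e3] at hboch
  rw [e1] at e4
  -- combine
  have hw' : w = k * Φ := hkw.symm
  have c1 : Φ * (-2 * A * w + 2 * (E - 1) * (-k * s) + 2 * E * w ^ 2)
      ≤ Φ * (lw - -k * fΦ - wt) := mul_le_mul_of_nonneg_left hboch hΦ.le
  have c2 : w * (lΦ - fΦ - Φt) - 2 * k * S
      + Φ * (-2 * A * w + 2 * (E - 1) * (-k * s) + 2 * E * w ^ 2) ≤ 0 := by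
    have : w * fΦ = k * Φ * fΦ := by rw [← hw']
    nlinarith
  have c3 : k * (Φ * (lΦ - fΦ - Φt) - 2 * S - 2 * A * Φ ^ 2 - 2 * (E - 1) * Φ * s
      + 2 * E * Φ ^ 2 * w) ≤ 0 := by
    have : w * (lΦ - fΦ - Φt) - 2 * k * S
      + Φ * (-2 * A * w + 2 * (E - 1) * (-k * s) + 2 * E * w ^ 2) =
      k * (Φ * (lΦ - fΦ - Φt) - 2 * S - 2 * A * Φ ^ 2 - 2 * (E - 1) * Φ * s
      + 2 * E * Φ ^ 2 * w) := by
      have h5 : Φ * w ^ 2 = k * Φ ^ 2 * w := by rw [hw']; ring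
      have h6 : w * (lΦ - fΦ - Φt) = k * Φ * (lΦ - fΦ - Φt) := by rw [← hw']
      have h7 : Φ * w = k * Φ ^ 2 := by rw [hw']; ring
      linear_combination h6 + 2 * E * h5 - 2 * A * h7
    linarith
  have c4 : Φ * (lΦ - fΦ - Φt) - 2 * S - 2 * A * Φ ^ 2 - 2 * (E - 1) * Φ * s
      + 2 * E * Φ ^ 2 * w ≤ 0 := by
    by_contra hcon
    push Not at hcon
    have := mul_pos hk hcon
    linarith
  have c5 : (E - 1) * (2 * Φ * s) ≤ (E - 1) * (Φ ^ 2 * w + 4 * B * Φ) :=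
    mul_le_mul_of_nonneg_left (by linarith) (by linarith)
  have c6 : Φ * ((lΦ - fΦ - Φt) - 8 * B - 2 * A * Φ - (E - 1) * (Φ * w + 4 * B)
      + 2 * E * Φ * w) ≤ 0 := by nlinarith
  have c7 : (lΦ - fΦ - Φt) - 8 * B - 2 * A * Φ - (E - 1) * (Φ * w + 4 * B)
      + 2 * E * Φ * w ≤ 0 := by
    by_contra hcon
    push Not at hcon
    have := mul_pos hΦ hcon
    linarith
  have c8 : (E + 1) * (Φ * w) ≤ (E + 1) * (4 * B + N) := by nlinarith [mul_nonneg (by linarith : 0 ≤ E) hN]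
  exact le_of_mul_le_mul_left c8 (by linarith)

/-- The cutoff profile. -/
lemma exists_cutoff : ∃ (Ψ : ℝ → ℝ) (M : ℝ), 1 ≤ M ∧ ContDiff ℝ (⊤ : ℕ∞) Ψ ∧
    (∀ σ ≤ 1/4, Ψ σ = 1) ∧ (∀ σ ≥ 9/16, Ψ σ = 0) ∧ (∀ σ, 0 ≤ Ψ σ) ∧ (∀ σ, Ψ σ ≤ 1) ∧
    (∀ σ < 1/4, deriv Ψ σ = 0) ∧ (∀ σ, deriv Ψ σ ≤ 0) ∧
    (∀ σ ∈ Icc (0:ℝ) 1, -deriv Ψ σ ≤ M ∧ (deriv Ψ σ) ^ 2 ≤ 4 * M * Ψ σ ∧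
      -deriv (deriv Ψ) σ ≤ M) := by
  let χ : ℝ → ℝ := fun σ => Real.smoothTransition ((9/16 - σ) * (16/5))
  have hχ : ContDiff ℝ (⊤ : ℕ∞) χ :=
    Real.smoothTransition.contDiff.comp (by fun_prop)
  have hχ0 : ∀ σ, 0 ≤ χ σ := fun σ => Real.smoothTransition.nonneg _
  have hχ1 : ∀ σ, χ σ ≤ 1 := fun σ => Real.smoothTransition.le_one _
  have hanti : Antitone χ := fun x y h => Real.smoothTransition.monotone (by linarith)
  let Ψ : ℝ → ℝ := fun σ => χ σ ^ 2
  have hΨ : ContDiff ℝ (⊤ : ℕ∞) Ψ := hχ.pow 2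
  have hΨ1 : ∀ σ ≤ 1/4, Ψ σ = 1 := by
    intro σ h
    have : χ σ = 1 := Real.smoothTransition.one_of_one_le (by linarith)
    simp [Ψ, this]
  have hdχ : ∀ σ, DifferentiableAt ℝ χ σ := fun σ => (hχ.differentiable (by simp)) σ
  have hdΨ : ∀ σ, deriv Ψ σ = 2 * χ σ * deriv χ σ := by
    intro σ
    have := ((hdχ σ).hasDerivAt.fun_pow 2).deriv
    simpa using this
  have c1 : Continuous (deriv χ) := hχ.continuous_deriv (by simp)
  have c2 : Continuous (deriv (deriv Ψ)) := by
    have h2 : ContDiff ℝ (1 + 1) Ψ := hΨ.of_le (by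
      exact (WithTop.coe_le_coe.2 le_top : ((2 : ℕ∞) : WithTop ℕ∞) ≤ ((⊤ : ℕ∞) : WithTop ℕ∞)))
    have : ContDiff ℝ 1 (deriv Ψ) := (contDiff_succ_iff_deriv.1 h2).2.2
    exact this.continuous_deriv le_rfl
  obtain ⟨M1, hM1⟩ := (isCompact_Icc (a := (0:ℝ)) (b := 1)).exists_bound_of_continuousOn c1.continuousOn
  obtain ⟨M2, hM2⟩ := (isCompact_Icc (a := (0:ℝ)) (b := 1)).exists_bound_of_continuousOn c2.continuousOn
  have hM1p : 0 ≤ M1 := (norm_nonneg _).trans (hM1 0 (by simp))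
  have hM2p : 0 ≤ M2 := (norm_nonneg _).trans (hM2 0 (by simp))
  refine ⟨Ψ, 1 + 2 * M1 + M1 ^ 2 + M2, by nlinarith, hΨ, hΨ1, ?_, fun σ => sq_nonneg _, ?_, ?_, ?_, ?_⟩
  · intro σ h
    have : χ σ = 0 := Real.smoothTransition.zero_of_nonpos (by linarith)
    simp [Ψ, this]
  · intro σ; exact pow_le_one₀ (hχ0 σ) (hχ1 σ)
  · intro σ h
    have : Ψ =ᶠ[nhds σ] fun _ => 1 := by
      filter_upwards [Iio_mem_nhds h] with y hy
      exact hΨ1 y hy.le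
    rw [this.deriv_eq]; simp
  · intro σ
    rw [hdΨ]
    have := hanti.deriv_nonpos (x := σ)
    nlinarith [hχ0 σ]
  · intro σ hσ
    have h1 := abs_le.1 (hM1 σ hσ)
    have h2 := abs_le.1 (hM2 σ hσ)
    have h3 : (deriv χ σ) ^ 2 ≤ M1 ^ 2 := sq_le_sq' h1.1 h1.2
    refine ⟨?_, ?_, ?_⟩
    · rw [hdΨ]; nlinarith [hχ0 σ, hχ1 σ, hanti.deriv_nonpos (x := σ), sq_nonneg M1]
    · rw [hdΨ]
      have : (2 * χ σ * deriv χ σ) ^ 2 = 4 * (deriv χ σ) ^ 2 * Ψ σ := by simp only [Ψ]; ring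
      rw [this]
      exact mul_le_mul_of_nonneg_right (by nlinarith) (sq_nonneg _)
    · nlinarith [h2.1, sq_nonneg M1]

section geometry
variable {n : ℕ}

lemma dd_slice {Ω : Set ((EuclideanSpace ℝ (Fin n)) × ℝ)} (hΩ : IsOpen Ω) {G : (EuclideanSpace ℝ (Fin n)) × ℝ → ℝ} (hG : Sm Ω G) {x : (EuclideanSpace ℝ (Fin n))} {t : ℝ}
    (hp : (x, t) ∈ Ω) (v : (EuclideanSpace ℝ (Fin n))) :
    dd (v, (0:ℝ)) G (x, t) = dd v (fun y => G (y, t)) x := by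
  have h := (hG.diffAt hΩ hp).hasFDerivAt
  have h1 : HasFDerivAt (fun y : (EuclideanSpace ℝ (Fin n)) => (y, t)) (ContinuousLinearMap.inl ℝ (EuclideanSpace ℝ (Fin n)) ℝ) x :=
    hasFDerivAt_prodMk_left x t
  have h2 : HasFDerivAt (fun y : (EuclideanSpace ℝ (Fin n)) => G (y, t))
    ((fderiv ℝ G (x, t)).comp (ContinuousLinearMap.inl ℝ (EuclideanSpace ℝ (Fin n)) ℝ)) x := h.comp x h1
  simp only [dd]
  rw [h2.fderiv]; simp

lemma dd_slice2 {Ω : Set ((EuclideanSpace ℝ (Fin n)) × ℝ)} (hΩ : IsOpen Ω) {G : (EuclideanSpace ℝ (Fin n)) × ℝ → ℝ} (hG : Sm Ω G) {x : (EuclideanSpace ℝ (Fin n))} {t : ℝ}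
    (hp : (x, t) ∈ Ω) (v v' : (EuclideanSpace ℝ (Fin n))) :
    dd (v', (0:ℝ)) (dd (v, (0:ℝ)) G) (x, t) = dd v' (dd v (fun y => G (y, t))) x := by
  rw [dd_slice hΩ (hG.dd hΩ _) hp]
  have ho : IsOpen {y : (EuclideanSpace ℝ (Fin n)) | (y, t) ∈ Ω} := hΩ.preimage (by fun_prop)
  exact dd_congr (Ω := {y : (EuclideanSpace ℝ (Fin n)) | (y, t) ∈ Ω}) ho hp fun q hq => dd_slice hΩ hG hq v

lemma dd_time {Ω : Set ((EuclideanSpace ℝ (Fin n)) × ℝ)} (hΩ : IsOpen Ω) {G : (EuclideanSpace ℝ (Fin n)) × ℝ → ℝ} (hG : Sm Ω G) {x : (EuclideanSpace ℝ (Fin n))} {t : ℝ}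
    (hp : (x, t) ∈ Ω) :
    dd ((0:(EuclideanSpace ℝ (Fin n))), (1:ℝ)) G (x, t) = deriv (fun s => G (x, s)) t := by
  have h := (hG.diffAt hΩ hp).hasFDerivAt
  have h1 : HasDerivAt (fun s : ℝ => (x, s)) ((0:(EuclideanSpace ℝ (Fin n))), (1:ℝ)) t :=
    (hasDerivAt_const t x).prodMk (hasDerivAt_id t)
  exact (h.comp_hasDerivAt t h1).deriv.symm

lemma eucl_sum (v : (EuclideanSpace ℝ (Fin n))) : v = ∑ i, v i • EuclideanSpace.single i (1:ℝ) := by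
  ext j
  simp [Pi.single_apply]

lemma dd_expand (h : (EuclideanSpace ℝ (Fin n)) → ℝ) (v x : (EuclideanSpace ℝ (Fin n))) :
    dd v h x = ∑ i, v i * dd (EuclideanSpace.single i (1:ℝ)) h x := by
  simp only [dd]
  conv_lhs => rw [eucl_sum v]
  simp

lemma hess_expand {f : (EuclideanSpace ℝ (Fin n)) → ℝ} (hf : ContDiff ℝ (⊤ : ℕ∞) f) (x v : (EuclideanSpace ℝ (Fin n))) :
    dd v (dd v f) x = ∑ j, ∑ i, dd (EuclideanSpace.single j (1:ℝ))
      (dd (EuclideanSpace.single i (1:ℝ)) f) x * v i * v j := by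
  have hs : Sm univ f := hf.contDiffOn
  have : dd v f = fun y => ∑ i, v i * dd (EuclideanSpace.single i (1:ℝ)) f y :=
    funext fun y => dd_expand f v y
  rw [dd_expand, this]
  refine Finset.sum_congr rfl fun j _ => ?_
  rw [dd_sum isOpen_univ (mem_univ x) fun i => (Sm.const _).mul (hs.dd isOpen_univ _),
    Finset.mul_sum]
  refine Finset.sum_congr rfl fun i _ => ?_
  rw [dd_mul isOpen_univ (mem_univ x) (Sm.const _) (hs.dd isOpen_univ _), dd_const]
  ring

lemma grad_inner (f : (EuclideanSpace ℝ (Fin n)) → ℝ) (x v : (EuclideanSpace ℝ (Fin n))) : ⟪gradient f x, v⟫ = dd v f x := by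
  simp [gradient, dd, InnerProductSpace.toDual_symm_apply]

lemma grad_apply (f : (EuclideanSpace ℝ (Fin n)) → ℝ) (x : (EuclideanSpace ℝ (Fin n))) (i : Fin n) :
    gradient f x i = dd (EuclideanSpace.single i (1:ℝ)) f x := by
  rw [← grad_inner]
  rw [EuclideanSpace.inner_single_right]; simp

lemma comparison {f : (EuclideanSpace ℝ (Fin n)) → ℝ} (hf : ContDiff ℝ (⊤ : ℕ∞) f) (hn : 1 ≤ n) {x₀ : (EuclideanSpace ℝ (Fin n))} {R K α : ℝ}
    (hK : 0 ≤ K)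
    (hess : ∀ x ∈ ball x₀ R, ∀ v : (EuclideanSpace ℝ (Fin n)), dd v (dd v f) x ≥ -((n : ℝ) - 1) * K * ‖v‖ ^ 2)
    (hα : ∀ y ∈ sphere x₀ 1, (n : ℝ) - 1 - dd (y - x₀) f y ≤ α)
    {x : (EuclideanSpace ℝ (Fin n))} (hx : x ∈ ball x₀ R) (h1 : 1 ≤ ‖x - x₀‖) :
    (n : ℝ) - dd (x - x₀) f x ≤ 1 + R * |α| + ((n : ℝ) - 1) * K * R ^ 2 := by
  set r := ‖x - x₀‖ with hr
  have hrR : r < R := by rwa [mem_ball_iff_norm] at hx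
  set e : (EuclideanSpace ℝ (Fin n)) := r⁻¹ • (x - x₀) with he
  have hr0 : 0 < r := by linarith
  have hne : ‖e‖ = 1 := by rw [he, norm_smul, ← hr]; simp only [norm_inv, Real.norm_eq_abs, abs_of_pos hr0]; field_simp
  have hxe : x - x₀ = r • e := by rw [he, smul_smul, mul_inv_cancel₀ hr0.ne', one_smul]
  have hs : Sm univ f := hf.contDiffOn
  have hn1 : (0:ℝ) ≤ (n:ℝ) - 1 := by
    have : (1:ℝ) ≤ n := by exact_mod_cast hn
    linarith
  have hsm : ∀ c : ℝ, ∀ z, dd (c • e) f z = c * dd e f z := by intro c z; simp [dd]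
  -- one-dimensional function
  have hder : ∀ s : ℝ, HasDerivAt (fun s : ℝ => dd e f (x₀ + s • e) + ((n:ℝ) - 1) * K * s)
      (dd e (dd e f) (x₀ + s • e) + ((n:ℝ) - 1) * K) s := by
    intro s
    have a1 := dd_line (v := e) (p := x₀) (s := s) isOpen_univ (mem_univ _) (hs.dd isOpen_univ e)
    have a2 := (hasDerivAt_id s).const_mul (((n:ℝ) - 1) * K)
    simpa using a1.fun_add a2
  have hmono : MonotoneOn (fun s : ℝ => dd e f (x₀ + s • e) + ((n:ℝ) - 1) * K * s) (Icc 1 r) := by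
    apply monotoneOn_of_deriv_nonneg (convex_Icc 1 r)
    · exact fun s _ => (hder s).continuousAt.continuousWithinAt
    · exact fun s _ => (hder s).differentiableAt.differentiableWithinAt
    · intro s hs
      rw [interior_Icc] at hs
      rw [(hder s).deriv]
      have hin : x₀ + s • e ∈ ball x₀ R := by
        rw [mem_ball_iff_norm, add_sub_cancel_left, norm_smul, hne, mul_one, Real.norm_eq_abs,
          abs_of_pos (by linarith [hs.1])]
        linarith [hs.2]
      have := hess _ hin e
      rw [hne] at this
      linarith
  have hm := hmono (left_mem_Icc.2 h1) (right_mem_Icc.2 h1) h1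
  simp only [one_smul] at hm
  have hy := hα (x₀ + e) (by simp [hne])
  rw [add_sub_cancel_left] at hy
  have hx' : x₀ + r • e = x := by rw [← hxe]; abel
  rw [hx'] at hm
  rw [hxe, hsm]
  have hαa := le_abs_self α
  have h5 : dd e f x ≥ (n:ℝ) - 1 - |α| - ((n:ℝ) - 1) * K * (r - 1) := by linarith
  have h6 := mul_le_mul_of_nonneg_left h5.le hr0.le
  have h7 : r * |α| ≤ R * |α| := mul_le_mul_of_nonneg_right hrR.le (abs_nonneg _)
  have h8 : ((n:ℝ) - 1) * K * (r * (r - 1)) ≤ ((n:ℝ) - 1) * K * R ^ 2 :=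
    mul_le_mul_of_nonneg_left (by nlinarith) (mul_nonneg hn1 hK)
  nlinarith
end geometry

section interior
variable {n : ℕ}

/-- basis directions in space-time -/
def eb (i : Fin n) : (EuclideanSpace ℝ (Fin n)) × ℝ := (EuclideanSpace.single i (1:ℝ), 0)

/-- time direction -/
def et : (EuclideanSpace ℝ (Fin n)) × ℝ := (0, 1)

/-- squared distance over R² -/
def rho (x₀ : (EuclideanSpace ℝ (Fin n))) (R : ℝ) : (EuclideanSpace ℝ (Fin n)) × ℝ → ℝ := fun p => ‖p.1 - x₀‖ ^ 2 * (R ^ 2)⁻¹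

lemma rho_sm (x₀ : (EuclideanSpace ℝ (Fin n))) (R : ℝ) : Sm univ (rho x₀ R) := by
  have : ContDiff ℝ (⊤ : ℕ∞) (rho x₀ R) :=
    ((contDiff_fst.sub contDiff_const).norm_sq ℝ).mul contDiff_const
  exact this.contDiffOn

lemma rho_fderiv (x₀ : (EuclideanSpace ℝ (Fin n))) (R : ℝ) (p v : (EuclideanSpace ℝ (Fin n)) × ℝ) :
    dd v (rho x₀ R) p = 2 * ⟪p.1 - x₀, v.1⟫ * (R ^ 2)⁻¹ := by
  have h1 : HasFDerivAt (fun p : (EuclideanSpace ℝ (Fin n)) × ℝ => p.1 - x₀) (ContinuousLinearMap.fst ℝ (EuclideanSpace ℝ (Fin n)) ℝ) p :=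
    hasFDerivAt_fst.sub_const x₀
  have h2 := h1.norm_sq.mul_const ((R ^ 2)⁻¹)
  have h3 : dd v (rho x₀ R) p = _ := congrArg (fun L => L v) h2.fderiv
  rw [h3]
  simp [inner_sub_left]
  ring

lemma rho_i (x₀ : (EuclideanSpace ℝ (Fin n))) (R : ℝ) (p : (EuclideanSpace ℝ (Fin n)) × ℝ) (i : Fin n) :
    dd (eb i) (rho x₀ R) p = (p.1 i - x₀ i) * (2 * (R ^ 2)⁻¹) := by
  rw [rho_fderiv, eb, EuclideanSpace.inner_single_right]; simp; ring

lemma rho_t (x₀ : (EuclideanSpace ℝ (Fin n))) (R : ℝ) (p : (EuclideanSpace ℝ (Fin n)) × ℝ) :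
    dd et (rho x₀ R) p = 0 := by
  rw [rho_fderiv, et]; simp

lemma rho_ii (x₀ : (EuclideanSpace ℝ (Fin n))) (R : ℝ) (p : (EuclideanSpace ℝ (Fin n)) × ℝ) (i : Fin n) :
    dd (eb i) (dd (eb i) (rho x₀ R)) p = 2 * (R ^ 2)⁻¹ := by
  have h0 : dd (eb i) (rho x₀ R) = fun p : (EuclideanSpace ℝ (Fin n)) × ℝ => (p.1 i - x₀ i) * (2 * (R ^ 2)⁻¹) :=
    funext fun p => rho_i x₀ R p i
  rw [h0]
  have h1 : HasFDerivAt (fun p : (EuclideanSpace ℝ (Fin n)) × ℝ => p.1 i)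
      ((EuclideanSpace.proj i : (EuclideanSpace ℝ (Fin n)) →L[ℝ] ℝ).comp (ContinuousLinearMap.fst ℝ (EuclideanSpace ℝ (Fin n)) ℝ)) p :=
    ((EuclideanSpace.proj i : (EuclideanSpace ℝ (Fin n)) →L[ℝ] ℝ).comp (ContinuousLinearMap.fst ℝ (EuclideanSpace ℝ (Fin n)) ℝ)).hasFDerivAt
  have h2 := (h1.sub_const (x₀ i)).mul_const (2 * (R ^ 2)⁻¹)
  simp only [dd]
  rw [h2.fderiv]
  simp [eb]

lemma rho_grad_sq (x₀ : (EuclideanSpace ℝ (Fin n))) {R : ℝ} (hR : 0 < R) (p : (EuclideanSpace ℝ (Fin n)) × ℝ) :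
    ∑ i, (dd (eb i) (rho x₀ R) p) ^ 2 = 4 * (R ^ 2)⁻¹ * rho x₀ R p := by
  simp only [rho_i, rho]
  rw [EuclideanSpace.norm_sq_eq, Finset.sum_mul, Finset.mul_sum]
  refine Finset.sum_congr rfl fun i _ => ?_
  simp only [PiLp.sub_apply, Real.norm_eq_abs, sq_abs]
  ring

/-- cutoff bounds -/
lemma cutoff_bounds (hn : 1 ≤ n) {Ψ : ℝ → ℝ} {M : ℝ} (hM : 1 ≤ M)
    (hΨ : ContDiff ℝ (⊤ : ℕ∞) Ψ)
    (Ψ0 : ∀ σ, 0 ≤ Ψ σ) (Ψle : ∀ σ, Ψ σ ≤ 1)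
    (Ψd0 : ∀ σ < 1/4, deriv Ψ σ = 0) (Ψd : ∀ σ, deriv Ψ σ ≤ 0)
    (ΨM : ∀ σ ∈ Icc (0:ℝ) 1, -deriv Ψ σ ≤ M ∧ (deriv Ψ σ) ^ 2 ≤ 4 * M * Ψ σ ∧
      -deriv (deriv Ψ) σ ≤ M)
    {f : (EuclideanSpace ℝ (Fin n)) → ℝ} (hf : ContDiff ℝ (⊤ : ℕ∞) f) {x₀ : (EuclideanSpace ℝ (Fin n))} {R K α : ℝ} (hR : 2 ≤ R)
    (hK : 0 ≤ K)
    (hess : ∀ x ∈ ball x₀ R, ∀ v : (EuclideanSpace ℝ (Fin n)), dd v (dd v f) x ≥ -((n : ℝ) - 1) * K * ‖v‖ ^ 2)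
    (hα : ∀ y ∈ sphere x₀ 1, (n : ℝ) - 1 - dd (y - x₀) f y ≤ α) (s : ℝ)
    {Φ : (EuclideanSpace ℝ (Fin n)) × ℝ → ℝ} (hΦ : Φ = fun p => (p.2 - s) * Ψ (rho x₀ R p))
    {p : (EuclideanSpace ℝ (Fin n)) × ℝ} (hp : p.1 ∈ ball x₀ R) (hs : s ≤ p.2) :
    Sm univ Φ ∧
    ∑ i, (dd (eb i) Φ p) ^ 2 ≤ 4 * ((p.2 - s) * (4 * M / R ^ 2)) * Φ p ∧
    -((∑ i, dd (eb i) (dd (eb i) Φ) p) - (∑ i, dd (eb i) (fun q => f q.1) p * dd (eb i) Φ p)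
        - dd et Φ p) ≤ (p.2 - s) * (4 * M / R ^ 2 +
          2 * M * (1 + R * |α| + ((n : ℝ) - 1) * K * R ^ 2) / R ^ 2) + 1 := by
  have ho := isOpen_univ (X := (EuclideanSpace ℝ (Fin n)) × ℝ)
  have hρ := rho_sm x₀ R
  have hρp : rho x₀ R p ∈ Icc (0:ℝ) 1 := by
    have h0 : ‖p.1 - x₀‖ < R := by rwa [mem_ball_iff_norm] at hp
    refine ⟨by unfold rho; positivity, ?_⟩
    unfold rho
    rw [← div_eq_mul_inv, div_le_one (by positivity)]
    exact pow_le_pow_left₀ (norm_nonneg _) h0.le 2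
  obtain ⟨hM1, hM2, hM3⟩ := ΨM _ hρp
  have hΨ' : ContDiff ℝ (⊤ : ℕ∞) (deriv Ψ) := (contDiff_infty_iff_deriv.1 hΨ).2
  have hA : Sm univ (fun q : (EuclideanSpace ℝ (Fin n)) × ℝ => q.2 - s) := (contDiff_snd.sub contDiff_const).contDiffOn
  have hB : Sm univ (fun q : (EuclideanSpace ℝ (Fin n)) × ℝ => Ψ (rho x₀ R q)) :=
    (hΨ.comp (contDiffOn_univ.1 hρ)).contDiffOn
  have hC : Sm univ (fun q : (EuclideanSpace ℝ (Fin n)) × ℝ => deriv Ψ (rho x₀ R q)) :=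
    (hΨ'.comp (contDiffOn_univ.1 hρ)).contDiffOn
  have hAd : ∀ v q, dd v (fun q : (EuclideanSpace ℝ (Fin n)) × ℝ => q.2 - s) q = v.2 := by
    intro v q
    have : HasFDerivAt (fun q : (EuclideanSpace ℝ (Fin n)) × ℝ => q.2 - s) (ContinuousLinearMap.snd ℝ (EuclideanSpace ℝ (Fin n)) ℝ) q :=
      hasFDerivAt_snd.sub_const s
    simp only [dd]; rw [this.fderiv]; simp
  have hBd : ∀ v q, dd v (fun q : (EuclideanSpace ℝ (Fin n)) × ℝ => Ψ (rho x₀ R q)) q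
      = deriv Ψ (rho x₀ R q) * dd v (rho x₀ R) q := fun v q =>
    dd_comp ho (mem_univ _) hρ ((hΨ.differentiable (by simp)) _).hasDerivAt
  have hCd : ∀ v q, dd v (fun q : (EuclideanSpace ℝ (Fin n)) × ℝ => deriv Ψ (rho x₀ R q)) q
      = deriv (deriv Ψ) (rho x₀ R q) * dd v (rho x₀ R) q := fun v q =>
    dd_comp ho (mem_univ _) hρ ((hΨ'.differentiable (by simp)) _).hasDerivAt
  have hΦs : Sm univ Φ := by rw [hΦ]; exact hA.mul hB
  have d1 : ∀ v q, dd v Φ q = v.2 * Ψ (rho x₀ R q) +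
      (q.2 - s) * (deriv Ψ (rho x₀ R q) * dd v (rho x₀ R) q) := by
    intro v q
    rw [hΦ, dd_mul ho (mem_univ _) hA hB, hAd, hBd]
  have d1i : ∀ i q, dd (eb i) Φ q =
      (q.2 - s) * (deriv Ψ (rho x₀ R q) * dd (eb i) (rho x₀ R) q) := by
    intro i q; rw [d1]; simp [eb]
  have d2i : ∀ i, dd (eb i) (dd (eb i) Φ) p = (p.2 - s) *
      (deriv (deriv Ψ) (rho x₀ R p) * (dd (eb i) (rho x₀ R) p) ^ 2
        + deriv Ψ (rho x₀ R p) * (2 * (R ^ 2)⁻¹)) := by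
    intro i
    have hr := hρ.dd ho (eb i)
    rw [dd_congr ho (mem_univ p) (fun q _ => d1i i q), dd_mul ho (mem_univ _) hA (hC.mul hr),
      dd_mul ho (mem_univ _) hC hr, hAd, hCd, rho_ii]
    simp only [eb]; ring
  have dt : dd et Φ p = Ψ (rho x₀ R p) := by rw [d1, rho_t]; simp [et]
  have hgr := rho_grad_sq x₀ (by linarith : 0 < R) p
  have hR2 : 0 < (R ^ 2)⁻¹ := by positivity
  have hτ : 0 ≤ p.2 - s := by linarith
  refine ⟨hΦs, ?_, ?_⟩
  · have e1 : ∑ i, (dd (eb i) Φ p) ^ 2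
        = ((p.2 - s) ^ 2 * (4 * (R ^ 2)⁻¹)) * ((deriv Ψ (rho x₀ R p)) ^ 2 * rho x₀ R p) := by
      have : ∀ i, (dd (eb i) Φ p) ^ 2 = (p.2 - s) ^ 2 * (deriv Ψ (rho x₀ R p)) ^ 2 *
        (dd (eb i) (rho x₀ R) p) ^ 2 := fun i => by rw [d1i]; ring
      simp only [this]
      rw [← Finset.mul_sum, hgr]; ring
    have e2 : (deriv Ψ (rho x₀ R p)) ^ 2 * rho x₀ R p ≤ 4 * M * Ψ (rho x₀ R p) := by
      have := mul_le_of_le_one_right (sq_nonneg (deriv Ψ (rho x₀ R p))) hρp.2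
      linarith
    rw [e1]
    calc _ ≤ ((p.2 - s) ^ 2 * (4 * (R ^ 2)⁻¹)) * (4 * M * Ψ (rho x₀ R p)) :=
          mul_le_mul_of_nonneg_left e2 (by positivity)
      _ = _ := by rw [hΦ]; ring
  · have e1 : ∑ i, dd (eb i) (fun q : (EuclideanSpace ℝ (Fin n)) × ℝ => f q.1) p * dd (eb i) Φ p
        = (p.2 - s) * deriv Ψ (rho x₀ R p) * (2 * (R ^ 2)⁻¹) * dd (p.1 - x₀) f p.1 := by
      rw [dd_expand f (p.1 - x₀), Finset.mul_sum]
      refine Finset.sum_congr rfl fun i _ => ?_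
      have hF : Sm univ (fun q : (EuclideanSpace ℝ (Fin n)) × ℝ => f q.1) := (hf.comp contDiff_fst).contDiffOn
      have := dd_slice ho hF (mem_univ (p.1, p.2)) (EuclideanSpace.single i (1:ℝ))
      rw [d1i, rho_i]
      have h' : dd (eb i) (fun q : (EuclideanSpace ℝ (Fin n)) × ℝ => f q.1) p = dd (EuclideanSpace.single i (1:ℝ)) f p.1 :=
        this
      rw [h']
      simp only [PiLp.sub_apply]
      ring
    have e2 : ∑ i, dd (eb i) (dd (eb i) Φ) p = (p.2 - s) *
        (deriv (deriv Ψ) (rho x₀ R p) * (4 * (R ^ 2)⁻¹ * rho x₀ R p)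
          + n * (deriv Ψ (rho x₀ R p) * (2 * (R ^ 2)⁻¹))) := by
      simp only [d2i]
      rw [← Finset.mul_sum, Finset.sum_add_distrib, ← Finset.mul_sum, hgr]
      simp
    rw [e1, e2, dt]
    set Y := 1 + R * |α| + ((n : ℝ) - 1) * K * R ^ 2 with hY
    have hn1 : (0:ℝ) ≤ (n:ℝ) - 1 := by
      have : (1:ℝ) ≤ n := by exact_mod_cast hn
      linarith
    have hY0 : 0 ≤ Y := by positivity
    have k1 : -deriv (deriv Ψ) (rho x₀ R p) * rho x₀ R p ≤ M := by
      nlinarith [hρp.1, hρp.2]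
    have k2 : -deriv Ψ (rho x₀ R p) * (n - dd (p.1 - x₀) f p.1) ≤ M * Y := by
      rcases lt_or_ge (rho x₀ R p) (1/4) with h | h
      · rw [Ψd0 _ h]; simp only [neg_zero, zero_mul]; positivity
      · have hr : 1 ≤ ‖p.1 - x₀‖ := by
          unfold rho at h
          rw [← div_eq_mul_inv, le_div_iff₀ (by positivity)] at h
          nlinarith [norm_nonneg (p.1 - x₀)]
        have := comparison hf hn hK hess hα hp hr
        calc _ ≤ -deriv Ψ (rho x₀ R p) * Y :=
              mul_le_mul_of_nonneg_left this (by linarith [Ψd (rho x₀ R p)])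
          _ ≤ _ := mul_le_mul_of_nonneg_right hM1 hY0
    have k3 := Ψle (rho x₀ R p)
    have k4 : (p.2 - s) * (R ^ 2)⁻¹ * (4 * (-deriv (deriv Ψ) (rho x₀ R p) * rho x₀ R p) +
        2 * (-deriv Ψ (rho x₀ R p) * (n - dd (p.1 - x₀) f p.1)))
        ≤ (p.2 - s) * (R ^ 2)⁻¹ * (4 * M + 2 * (M * Y)) :=
      mul_le_mul_of_nonneg_left (by linarith) (by positivity)
    have k5 : (p.2 - s) * (4 * M / R ^ 2 + 2 * M * Y / R ^ 2)
      = (p.2 - s) * (R ^ 2)⁻¹ * (4 * M + 2 * (M * Y)) := by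
      rw [div_eq_mul_inv, div_eq_mul_inv]; ring
    rw [k5]
    linarith

end interior

section interior2
variable {n : ℕ}

set_option maxHeartbeats 4000000 in
/-- The interior estimate by the maximum principle. -/
lemma interior_est (hn : 1 ≤ n) {Ψ : ℝ → ℝ} {M : ℝ} (hM : 1 ≤ M)
    (hΨ : ContDiff ℝ (⊤ : ℕ∞) Ψ)
    (Ψ1 : ∀ σ ≤ 1/4, Ψ σ = 1) (Ψz : ∀ σ ≥ 9/16, Ψ σ = 0)
    (Ψ0 : ∀ σ, 0 ≤ Ψ σ) (Ψle : ∀ σ, Ψ σ ≤ 1)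
    (Ψd0 : ∀ σ < 1/4, deriv Ψ σ = 0) (Ψd : ∀ σ, deriv Ψ σ ≤ 0)
    (ΨM : ∀ σ ∈ Icc (0:ℝ) 1, -deriv Ψ σ ≤ M ∧ (deriv Ψ σ) ^ 2 ≤ 4 * M * Ψ σ ∧
      -deriv (deriv Ψ) σ ≤ M)
    {f : (EuclideanSpace ℝ (Fin n)) → ℝ} (hf : ContDiff ℝ (⊤ : ℕ∞) f) {x₀ : (EuclideanSpace ℝ (Fin n))} {R K α : ℝ} (hR : 2 ≤ R)
    (hK : 0 ≤ K)
    (hess : ∀ x ∈ ball x₀ R, ∀ v : (EuclideanSpace ℝ (Fin n)), dd v (dd v f) x ≥ -((n : ℝ) - 1) * K * ‖v‖ ^ 2)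
    (hα : ∀ y ∈ sphere x₀ 1, (n : ℝ) - 1 - dd (y - x₀) f y ≤ α)
    {t₁ t₂ a b A₁ : ℝ} {Ω : Set ((EuclideanSpace ℝ (Fin n)) × ℝ)} (hΩe : Ω = ball x₀ R ×ˢ Ioo t₁ t₂) {G w : (EuclideanSpace ℝ (Fin n)) × ℝ → ℝ}
    (hG : Sm Ω G) (hG0 : ∀ q ∈ Ω, 0 ≤ G q) (hA₁ : 0 ≤ A₁)
    (hb : ∀ q ∈ Ω, -A₁ ≤ -b * Real.exp (-1 * G q))
    (hw : w = fun p => ∑ j, dd (eb j) G p * dd (eb j) G p)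
    (pde : ∀ q ∈ Ω, dd et G q = (∑ i, dd (eb i) (dd (eb i) G) q) + (-1) *
      (∑ i, dd (eb i) (fun q => f q.1) q * dd (eb i) G q) + (1 + (-1) * Real.exp (G q)) * w q
        + (a + (-b) * Real.exp (-1 * G q)))
    {s t : ℝ} (hs : t₁ < s) (hst : s < t) (ht : t < t₂) {x : (EuclideanSpace ℝ (Fin n))} (hx : x ∈ ball x₀ (R / 2)) :
    (t - s) * w (x, t) ≤ (t - s) * (4 * (4 * M / R ^ 2) + (4 * M / R ^ 2 +
          2 * M * (1 + R * |α| + ((n : ℝ) - 1) * K * R ^ 2) / R ^ 2)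
          + 2 * (((n : ℝ) - 1) * K + A₁)) + 1 := by
  have hΩ : IsOpen Ω := by rw [hΩe]; exact isOpen_ball.prod isOpen_Ioo
  have hn1 : (0:ℝ) ≤ (n:ℝ) - 1 := by
    have : (1:ℝ) ≤ n := by exact_mod_cast hn
    linarith
  have hR0 : 0 < R := by linarith
  set Φ : (EuclideanSpace ℝ (Fin n)) × ℝ → ℝ := fun p => (p.2 - s) * Ψ (rho x₀ R p) with hΦ
  have hcut := fun (p : (EuclideanSpace ℝ (Fin n)) × ℝ) (hp : p.1 ∈ ball x₀ R) (hs : s ≤ p.2) =>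
    cutoff_bounds hn hM hΨ Ψ0 Ψle Ψd0 Ψd ΨM hf hR hK hess hα s hΦ hp hs
  have hxR : x ∈ ball x₀ R := ball_subset_ball (by linarith) hx
  have hΦs : Sm Ω Φ := ContDiffOn.mono (hcut (x, t) hxR hst.le).1 (subset_univ _)
  have hGi : ∀ i, Sm Ω (dd (eb i) G) := fun i => hG.dd hΩ _
  have hws : Sm Ω w := by rw [hw]; exact Sm.sum fun j => (hGi j).mul (hGi j)
  have hFs : Sm Ω (fun q : (EuclideanSpace ℝ (Fin n)) × ℝ => f q.1) := (hf.comp contDiff_fst).contDiffOn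
  have hw0 : ∀ q, 0 ≤ w q := by
    intro q; rw [hw]; exact Finset.sum_nonneg fun j _ => mul_self_nonneg _
  set P : (EuclideanSpace ℝ (Fin n)) × ℝ → ℝ := fun p => Φ p * w p with hP
  have hPs : Sm Ω P := hΦs.mul hws
  set S : Set ((EuclideanSpace ℝ (Fin n)) × ℝ) := closedBall x₀ (3 * R / 4) ×ˢ Icc s t with hS
  have hSΩ : S ⊆ Ω := by
    rw [hΩe]
    exact prod_mono (closedBall_subset_ball (by linarith))
      (fun r hr => ⟨by linarith [hr.1], by linarith [hr.2]⟩)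
  have hScomp : IsCompact S := (isCompact_closedBall _ _).prod isCompact_Icc
  have hxtS : (x, t) ∈ S := ⟨ball_subset_closedBall (ball_subset_ball (by linarith) hx),
    right_mem_Icc.2 hst.le⟩
  obtain ⟨p, hpS, hpmax⟩ := hScomp.exists_isMaxOn ⟨_, hxtS⟩
    ((ContDiffOn.continuousOn hPs).mono hSΩ)
  have hle : P (x, t) ≤ P p := hpmax hxtS
  have hPx : P (x, t) = (t - s) * w (x, t) := by
    have : rho x₀ R (x, t) ≤ 1/4 := by
      unfold rho
      rw [mem_ball_iff_norm] at hx
      rw [← div_eq_mul_inv, div_le_iff₀ (by positivity)]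
      nlinarith [norm_nonneg (x - x₀)]
    simp only [hP, hΦ, Ψ1 _ this, mul_one]
  rw [← hPx]
  refine hle.trans ?_
  set C1 := 4 * M / R ^ 2 with hC1
  set C2 := 4 * M / R ^ 2 + 2 * M * (1 + R * |α| + ((n : ℝ) - 1) * K * R ^ 2) / R ^ 2 with hC2
  have hC1p : 0 ≤ C1 := by positivity
  have hC2p : 0 ≤ C2 := by positivity
  set A := ((n : ℝ) - 1) * K + A₁ with hA
  have hAp : 0 ≤ A := by positivity
  have hts : 0 < t - s := by linarith
  rcases le_or_gt (P p) 0 with hneg | hpos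
  · exact hneg.trans (by positivity)
  obtain ⟨hp1, hp2⟩ := hpS
  have hpΩ : p ∈ Ω := hSΩ ⟨hp1, hp2⟩
  have hwp : 0 < w p := by
    rcases (hw0 p).lt_or_eq with h | h
    · exact h
    · simp only [hP, ← h, mul_zero, lt_self_iff_false] at hpos
  have hΦp : 0 < Φ p := by
    by_contra hcon
    push Not at hcon
    have : P p ≤ 0 := mul_nonpos_of_nonpos_of_nonneg hcon hwp.le
    linarith
  have hsp : s < p.2 := by
    rcases hp2.1.lt_or_eq with h | h
    · exact h
    · simp only [hΦ, ← h, sub_self, zero_mul, lt_self_iff_false] at hΦp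
  have hrp : rho x₀ R p < 9/16 := by
    by_contra hcon
    push Not at hcon
    simp only [hΦ, Ψz _ hcon, mul_zero, lt_self_iff_false] at hΦp
  have hpball : p.1 ∈ ball x₀ (3 * R / 4) := by
    rw [mem_ball_iff_norm]
    unfold rho at hrp
    rw [← div_eq_mul_inv, div_lt_iff₀ (by positivity)] at hrp
    by_contra hcon
    push Not at hcon
    nlinarith
  have hpR : p.1 ∈ ball x₀ R := ball_subset_ball (by linarith) hpball
  -- conditions at the maximum
  have hline : ∀ i, dd (eb i) P p = 0 ∧ dd (eb i) (dd (eb i) P) p ≤ 0 := by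
    intro i
    apply max_line hΩ hpΩ hPs
    have hc : ContinuousAt (fun r : ℝ => (p + r • (eb i : (EuclideanSpace ℝ (Fin n)) × ℝ)).1) 0 := by fun_prop
    have hev : ∀ᶠ r : ℝ in nhds 0, (p + r • (eb i : (EuclideanSpace ℝ (Fin n)) × ℝ)).1 ∈ ball x₀ (3 * R / 4) := by
      apply hc.eventually_mem
      simpa using isOpen_ball.mem_nhds hpball
    filter_upwards [hev] with r hr
    have : p + r • (eb i : (EuclideanSpace ℝ (Fin n)) × ℝ) ∈ S :=
      ⟨ball_subset_closedBall hr, by simpa [eb] using hp2⟩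
    have := hpmax this
    simpa using this
  have htime : 0 ≤ dd et P p := by
    have hloc : IsLocalMaxOn P S p := hpmax.localize
    have hy : ((0:(EuclideanSpace ℝ (Fin n))), -(p.2 - s)) ∈ posTangentConeAt S p := by
      apply mem_posTangentConeAt_of_segment_subset
      have hconv : Convex ℝ S := (convex_closedBall _ _).prod (convex_Icc _ _)
      apply hconv.segment_subset ⟨hp1, hp2⟩
      exact ⟨by simpa using hp1, by simp; linarith⟩
    have hd := hloc.hasFDerivWithinAt_nonpos
      (hPs.diffAt hΩ hpΩ).hasFDerivAt.hasFDerivWithinAt hy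
    have he : ((0:(EuclideanSpace ℝ (Fin n))), -(p.2 - s)) = (-(p.2 - s)) • (et : (EuclideanSpace ℝ (Fin n)) × ℝ) := by simp [et]
    rw [he, map_smul, smul_eq_mul] at hd
    have hd' : -(p.2 - s) * dd et P p ≤ 0 := hd
    nlinarith
  obtain ⟨-, hS1, hL1⟩ := hcut p hpR hsp.le
  have hΦle : Φ p ≤ p.2 - s := by
    have := mul_le_mul_of_nonneg_left (Ψle (rho x₀ R p)) (by linarith : 0 ≤ p.2 - s)
    simpa [hΦ] using this
  have hE : 1 ≤ Real.exp (G p) := Real.one_le_exp (hG0 p hpΩ)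
  have dP : ∀ v, ∀ q ∈ Ω, dd v P q = dd v Φ q * w q + Φ q * dd v w q :=
    fun v q hq => dd_mul hΩ hq hΦs hws
  have ddP : ∀ i, dd (eb i) (dd (eb i) P) p = dd (eb i) (dd (eb i) Φ) p * w p
      + 2 * (dd (eb i) Φ p * dd (eb i) w p) + Φ p * dd (eb i) (dd (eb i) w) p := by
    intro i
    rw [dd_congr hΩ hpΩ (dP (eb i)), dd_add hΩ hpΩ ((hΦs.dd hΩ _).mul hws) (hΦs.mul (hws.dd hΩ _)),
      dd_mul hΩ hpΩ (hΦs.dd hΩ _) hws, dd_mul hΩ hpΩ hΦs (hws.dd hΩ _)]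
    ring
  have hbo := bochner hΩ eb et hG hFs a b hw pde hpΩ
  have hwpe : w p = ∑ j, dd (eb j) G p * dd (eb j) G p := by rw [hw]
  -- Hessian term
  have hH : -(((n:ℝ) - 1) * K * w p) ≤
      ∑ j, ∑ i, dd (eb j) (dd (eb i) (fun q : (EuclideanSpace ℝ (Fin n)) × ℝ => f q.1)) p * dd (eb i) G p * dd (eb j) G p := by
    set v : (EuclideanSpace ℝ (Fin n)) := WithLp.toLp 2 (fun i => dd (eb i) G p) with hv
    have h1 := hess p.1 hpR v
    rw [hess_expand hf] at h1
    have h2 : ‖v‖ ^ 2 = w p := by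
      rw [EuclideanSpace.norm_sq_eq, hwpe]
      refine Finset.sum_congr rfl fun i _ => ?_
      simp only [hv, Real.norm_eq_abs, sq_abs]; ring
    rw [h2] at h1
    have h3 : ∀ i j : Fin n, dd (eb j) (dd (eb i) (fun q : (EuclideanSpace ℝ (Fin n)) × ℝ => f q.1)) p
        = dd (EuclideanSpace.single j (1:ℝ)) (dd (EuclideanSpace.single i (1:ℝ)) f) p.1 :=
      fun i j => dd_slice2 hΩ hFs (x := p.1) (t := p.2) hpΩ _ _
    simp only [h3]
    simp only [hv] at h1
    linarith
  have hHess : 0 ≤ ∑ i, ∑ j, (dd (eb i) (dd (eb j) G) p) ^ 2 :=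
    Finset.sum_nonneg fun i _ => Finset.sum_nonneg fun j _ => sq_nonneg _
  have hbw := mul_le_mul_of_nonneg_right (hb p hpΩ) hwp.le
  have key := max_alg (fun i => dd (eb i) G p) (fun i => dd (eb i) Φ p) (fun i => dd (eb i) w p)
    (fun i => dd (eb i) (dd (eb i) Φ) p) (fun i => dd (eb i) (dd (eb i) w) p)
    (fun i => dd (eb i) (fun q : (EuclideanSpace ℝ (Fin n)) × ℝ => f q.1) p) (Φ p) (w p) (dd et Φ p) (dd et w p)
    (Real.exp (G p)) A ((p.2 - s) * C1) ((p.2 - s) * C2 + 1 + 2 * A * (p.2 - s))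
    hΦp hwp hE (by nlinarith [mul_nonneg hC2p (by linarith : 0 ≤ p.2 - s), mul_nonneg hAp (by linarith : 0 ≤ p.2 - s)]) hwpe.symm
    (fun i => by rw [← dP _ p hpΩ]; exact (hline i).1)
    (fun i => by rw [← ddP]; exact (hline i).2)
    (by rw [← dP _ p hpΩ]; exact htime)
    (by rw [hbo]; simp only [hA]; nlinarith)
    hS1
    (by nlinarith [mul_le_mul_of_nonneg_left hΦle hAp])
  have hfin : (p.2 - s) * (4 * C1 + C2 + 2 * A) ≤ (t - s) * (4 * C1 + C2 + 2 * A) :=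
    mul_le_mul_of_nonneg_right (by linarith [hp2.2]) (by positivity)
  show Φ p * w p ≤ _
  linarith

end interior2

section final
variable {n : ℕ}

lemma alpha_bound {f : (EuclideanSpace ℝ (Fin n)) → ℝ} (hf : ContDiff ℝ (⊤ : ℕ∞) f) (x₀ : (EuclideanSpace ℝ (Fin n))) :
    ∀ y ∈ sphere x₀ 1, (n : ℝ) - 1 - dd (y - x₀) f y ≤ alphaC f x₀ := by
  intro y hy
  have hc : Continuous (fun y : (EuclideanSpace ℝ (Fin n)) => (n : ℝ) - 1 - ⟪gradient f y, y - x₀⟫) := by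
    have h1 : Continuous (fderiv ℝ f) := hf.continuous_fderiv (by simp)
    have : (fun y : (EuclideanSpace ℝ (Fin n)) => (n : ℝ) - 1 - ⟪gradient f y, y - x₀⟫)
        = fun y => (n : ℝ) - 1 - fderiv ℝ f y (y - x₀) := by
      funext y; rw [grad_inner]; rfl
    rw [this]
    exact continuous_const.sub (h1.clm_apply (continuous_id.sub continuous_const))
  have hb : BddAbove ((fun y : (EuclideanSpace ℝ (Fin n)) => (n : ℝ) - 1 - ⟪gradient f y, y - x₀⟫) '' sphere x₀ 1) :=
    ((isCompact_sphere x₀ 1).image hc).bddAbove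
  rw [← grad_inner]
  exact le_csSup hb ⟨y, hy, rfl⟩

/-- The equation satisfied by `G = log (1 - log (u / D))`. -/
lemma logPDE {Ω : Set ((EuclideanSpace ℝ (Fin n)) × ℝ)} (hΩ : IsOpen Ω) {U F : (EuclideanSpace ℝ (Fin n)) × ℝ → ℝ} (hU : Sm Ω U) {a D : ℝ}
    (hpos : ∀ q ∈ Ω, 0 < U q) (hle : ∀ q ∈ Ω, U q ≤ D)
    (pde : ∀ q ∈ Ω, dd et U q = (∑ i, dd (eb i) (dd (eb i) U) q)
      - (∑ i, dd (eb i) F q * dd (eb i) U q) + a * U q * Real.log (U q))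
    {G : (EuclideanSpace ℝ (Fin n)) × ℝ → ℝ} (hG : G = fun q => Real.log (1 + Real.log D - Real.log (U q))) :
    Sm Ω G ∧ (∀ q ∈ Ω, 0 ≤ G q) ∧
    (∀ q ∈ Ω, ∀ v, dd v G q = -(U q * (1 + Real.log D - Real.log (U q)))⁻¹ * dd v U q) ∧
    ∀ q ∈ Ω, dd et G q = (∑ i, dd (eb i) (dd (eb i) G) q) + (-1) *
      (∑ i, dd (eb i) F q * dd (eb i) G q) + (1 + (-1) * Real.exp (G q)) *
        (∑ j, dd (eb j) G q * dd (eb j) G q)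
        + (a + (-(a * (1 + Real.log D))) * Real.exp (-1 * G q)) := by
  have hl : ∀ q ∈ Ω, 1 ≤ 1 + Real.log D - Real.log (U q) := by
    intro q hq
    have := Real.log_le_log (hpos q hq) (hle q hq)
    linarith
  have hls : Sm Ω (fun q => 1 + Real.log D - Real.log (U q)) :=
    contDiffOn_const.sub (ContDiffOn.log hU fun q hq => (hpos q hq).ne')
  have hGs : Sm Ω G := by
    rw [hG]; exact ContDiffOn.log hls fun q hq => by linarith [hl q hq]
  have hld : ∀ y : ℝ, 0 < y → HasDerivAt (fun y => 1 + Real.log D - Real.log y) (-y⁻¹) y :=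
    fun y hy => (Real.hasDerivAt_log hy.ne').const_sub _
  have d1 : ∀ q ∈ Ω, ∀ v, dd v G q = -(U q * (1 + Real.log D - Real.log (U q)))⁻¹ * dd v U q := by
    intro q hq v
    have h0 := hpos q hq
    have h1 := hl q hq
    have hd : HasDerivAt (fun y => Real.log (1 + Real.log D - Real.log y))
        (-(U q * (1 + Real.log D - Real.log (U q)))⁻¹) (U q) := by
      have := (hld (U q) h0).log (by linarith)
      convert this using 1
      rw [mul_inv]; field_simp
    rw [hG]
    exact dd_comp (φ := fun y => Real.log (1 + Real.log D - Real.log y)) hΩ hq hU hd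
  refine ⟨hGs, ?_, d1, ?_⟩
  · intro q hq; rw [hG]; exact Real.log_nonneg (hl q hq)
  intro q hq
  have h0 := hpos q hq
  have h1 := hl q hq
  have hgs : Sm Ω (fun q => -(U q * (1 + Real.log D - Real.log (U q)))⁻¹) := by
    have := ContDiffOn.inv (hU.mul hls) fun q hq =>
      (mul_pos (hpos q hq) (by linarith [hl q hq])).ne'
    exact this.neg
  have d2 : ∀ i, dd (eb i) (dd (eb i) G) q =
      (Real.log D - Real.log (U q)) * ((U q * (1 + Real.log D - Real.log (U q)))⁻¹) ^ 2
        * (dd (eb i) U q) ^ 2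
      + -(U q * (1 + Real.log D - Real.log (U q)))⁻¹ * dd (eb i) (dd (eb i) U) q := by
    intro i
    rw [dd_congr hΩ hq (fun q hq => d1 q hq (eb i)), dd_mul hΩ hq hgs (hU.dd hΩ _)]
    have hd : HasDerivAt (fun y => -(y * (1 + Real.log D - Real.log y))⁻¹)
        ((Real.log D - Real.log (U q)) * ((U q * (1 + Real.log D - Real.log (U q)))⁻¹) ^ 2)
        (U q) := by
      have h2 := ((hasDerivAt_id (U q)).fun_mul (hld (U q) h0)).fun_inv
        (mul_pos h0 (by linarith : (0:ℝ) < 1 + Real.log D - Real.log (U q))).ne'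
      have hl0 : (1 + Real.log D - Real.log (U q)) ≠ 0 := by linarith
      have h3 := h2.fun_neg
      simp only [id_eq] at h3
      refine h3.congr_deriv ?_
      have hu1 : U q * -(U q)⁻¹ = -1 := by field_simp
      rw [hu1, inv_pow, ← div_eq_mul_inv, ← neg_div]
      congr 1
      ring
    rw [dd_comp (φ := fun y => -(y * (1 + Real.log D - Real.log y))⁻¹) hΩ hq hU hd]
    ring
  have hexp : Real.exp (G q) = 1 + Real.log D - Real.log (U q) := by
    rw [hG]; exact Real.exp_log (by linarith)
  have hexp' : Real.exp (-1 * G q) = (1 + Real.log D - Real.log (U q))⁻¹ := by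
    rw [neg_one_mul, Real.exp_neg, hexp]
  rw [hexp, hexp', d1 q hq, pde q hq]
  simp only [d2, d1 q hq]
  rw [Finset.sum_add_distrib, ← Finset.mul_sum, ← Finset.mul_sum]
  set ℓ := 1 + Real.log D - Real.log (U q) with hℓ
  have s1 : ∑ i, dd (eb i) F q * (-(U q * ℓ)⁻¹ * dd (eb i) U q)
      = -(U q * ℓ)⁻¹ * ∑ i, dd (eb i) F q * dd (eb i) U q := by
    rw [Finset.mul_sum]; exact Finset.sum_congr rfl fun i _ => by ring
  have s2 : ∑ i, (-(U q * ℓ)⁻¹ * dd (eb i) U q) * (-(U q * ℓ)⁻¹ * dd (eb i) U q)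
      = ((U q * ℓ)⁻¹) ^ 2 * ∑ i, (dd (eb i) U q) ^ 2 := by
    rw [Finset.mul_sum]; exact Finset.sum_congr rfl fun i _ => by ring
  rw [s1, s2]
  have hℓ0 : 0 < ℓ := by linarith
  have s3 : -(U q * ℓ)⁻¹ * (a * U q * Real.log (U q)) = a + -(a * (1 + Real.log D)) * ℓ⁻¹ := by
    have : Real.log (U q) = 1 + Real.log D - ℓ := by rw [hℓ]; ring
    rw [this]; field_simp; ring
  have s4 : Real.log D - Real.log (U q) = ℓ - 1 := by rw [hℓ]; ring
  rw [s4]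
  linear_combination s3

lemma grad_norm_sq (g : (EuclideanSpace ℝ (Fin n)) → ℝ) (x : (EuclideanSpace ℝ (Fin n))) :
    ‖gradient g x‖ ^ 2 = ∑ i, (dd (EuclideanSpace.single i (1:ℝ)) g x) ^ 2 := by
  rw [EuclideanSpace.norm_sq_eq]
  refine Finset.sum_congr rfl fun i _ => ?_
  rw [grad_apply, Real.norm_eq_abs, sq_abs]

lemma grad_norm (g : (EuclideanSpace ℝ (Fin n)) → ℝ) (x : (EuclideanSpace ℝ (Fin n))) : ‖gradient g x‖ = ‖fderiv ℝ g x‖ := by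
  simp [gradient]

lemma final_num {R K α A₁ M τ w N : ℝ} (hN : 1 ≤ N) (hM : 1 ≤ M) (hR : 2 ≤ R) (hK : 0 ≤ K)
    (hA₁ : 0 ≤ A₁) (hτ : 0 < τ) (x4 : ℝ) (hx4 : 0 ≤ x4)
    (h : τ * w ≤ τ * (4 * (4 * M / R ^ 2) + (4 * M / R ^ 2 +
          2 * M * (1 + R * |α| + (N - 1) * K * R ^ 2) / R ^ 2) + 2 * ((N - 1) * K + A₁)) + 1) :
    w ≤ (24 * M * N * (Real.sqrt ((1 + |α|) / R) + 1 / Real.sqrt τ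
      + Real.sqrt K + x4 + Real.sqrt A₁)) ^ 2 := by
  have hR0 : 0 < R := by linarith
  set q1 := Real.sqrt ((1 + |α|) / R)
  set q2 := 1 / Real.sqrt τ with hq2
  set q3 := Real.sqrt K
  set q5 := Real.sqrt A₁
  have e1 : q1 ^ 2 = (1 + |α|) / R := Real.sq_sqrt (by positivity)
  have e2 : q2 ^ 2 = 1 / τ := by rw [hq2, div_pow, Real.sq_sqrt hτ.le]; simp
  have e3 : q3 ^ 2 = K := Real.sq_sqrt hK
  have e5 : q5 ^ 2 = A₁ := Real.sq_sqrt hA₁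
  have p1 : 0 ≤ q1 := Real.sqrt_nonneg _
  have p2 : 0 ≤ q2 := by positivity
  have p3 : 0 ≤ q3 := Real.sqrt_nonneg _
  have p5 : 0 ≤ q5 := Real.sqrt_nonneg _
  have hX : q1 ^ 2 + q2 ^ 2 + q3 ^ 2 + q5 ^ 2 ≤ (q1 + q2 + q3 + x4 + q5) ^ 2 := by
    have : (q1 + q2 + q3 + x4 + q5) ^ 2 = q1 ^ 2 + q2 ^ 2 + q3 ^ 2 + q5 ^ 2 +
      (x4 ^ 2 + 2 * (q1 * q2 + q1 * q3 + q1 * x4 + q1 * q5 + q2 * q3 + q2 * x4 + q2 * q5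
        + q3 * x4 + q3 * q5 + x4 * q5)) := by ring
    rw [this]
    exact le_add_of_nonneg_right (by positivity)
  have hw : w ≤ (22 * M / R ^ 2 + 2 * M * |α| / R + (2 * M + 2) * ((N - 1) * K) + 2 * A₁) + 1 / τ := by
    have hdiv : w ≤ (4 * (4 * M / R ^ 2) + (4 * M / R ^ 2 +
          2 * M * (1 + R * |α| + (N - 1) * K * R ^ 2) / R ^ 2) + 2 * ((N - 1) * K + A₁)) + 1 / τ := by
      have : τ * w ≤ τ * ((4 * (4 * M / R ^ 2) + (4 * M / R ^ 2 +
          2 * M * (1 + R * |α| + (N - 1) * K * R ^ 2) / R ^ 2) + 2 * ((N - 1) * K + A₁)) + 1 / τ) := by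
        rw [mul_add, mul_one_div_cancel hτ.ne']; exact h
      exact le_of_mul_le_mul_left this hτ
    refine hdiv.trans (le_of_eq ?_)
    field_simp; ring
  have r1 : 22 * M / R ^ 2 + 2 * M * |α| / R ≤ 24 * M * q1 ^ 2 := by
    rw [e1]
    have : 22 * M / R ^ 2 ≤ 22 * M / R :=
      div_le_div_of_nonneg_left (by linarith) hR0 (by nlinarith)
    have h2 : 24 * M * ((1 + |α|) / R) = 22 * M / R + 2 * M * |α| / R
      + (2 * M / R + 22 * M * |α| / R) := by ring
    rw [h2]
    have : 0 ≤ 2 * M / R + 22 * M * |α| / R := by positivity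
    linarith
  have r3 : (2 * M + 2) * ((N - 1) * K) ≤ 24 * M * N * q3 ^ 2 := by
    rw [e3]
    have : (2 * M + 2) * (N - 1) ≤ 24 * M * N := by nlinarith
    calc _ = (2 * M + 2) * (N - 1) * K := by ring
      _ ≤ _ := mul_le_mul_of_nonneg_right this hK
  have hMN : 1 ≤ M * N := by nlinarith
  have hMN' : 24 * M * N = 24 * (M * N) := by ring
  have r1' : 24 * M * q1 ^ 2 ≤ 24 * M * N * q1 ^ 2 :=
    mul_le_mul_of_nonneg_right (le_mul_of_one_le_right (by linarith) hN) (sq_nonneg _)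
  have r5 : 2 * A₁ ≤ 24 * M * N * q5 ^ 2 := by
    rw [e5]; exact mul_le_mul_of_nonneg_right (by linarith) hA₁
  have r2 : 1 / τ ≤ 24 * M * N * q2 ^ 2 := by
    rw [← e2]; exact le_mul_of_one_le_left (sq_nonneg q2) (by linarith)
  have r6 : 24 * M * N * (q1 ^ 2 + q2 ^ 2 + q3 ^ 2 + q5 ^ 2)
      ≤ (24 * M * N) ^ 2 * (q1 + q2 + q3 + x4 + q5) ^ 2 :=
    mul_le_mul (le_self_pow₀ (by linarith) two_ne_zero) hX (by positivity) (by positivity)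
  rw [mul_pow]
  linarith

end final

/-- Souplet-Zhang-type gradient estimate for the nonlinear `f`-heat equation, case `a < 0`
(Euclidean case of Theorem 1.4(ii)). -/
theorem souplet_zhang_gradient_estimate_neg (n : ℕ) (hn : 1 ≤ n) :
    ∃ c : ℝ, 0 < c ∧
      ∀ (f : EuclideanSpace ℝ (Fin n) → ℝ) (x₀ : EuclideanSpace ℝ (Fin n))
        (R K t₀ T a D : ℝ) (u : EuclideanSpace ℝ (Fin n) → ℝ → ℝ),
        ContDiff ℝ (⊤ : ℕ∞) f →
        2 ≤ R → 0 ≤ K → 0 < T → a < 0 → 0 < D →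
        (∀ x ∈ ball x₀ R, ∀ v : EuclideanSpace ℝ (Fin n),
          hessQF f x v ≥ -((n : ℝ) - 1) * K * ‖v‖ ^ 2) →
        ContDiffOn ℝ (⊤ : ℕ∞) (fun p : EuclideanSpace ℝ (Fin n) × ℝ => u p.1 p.2)
          (ball x₀ R ×ˢ Icc (t₀ - T) t₀) →
        (∀ x ∈ ball x₀ R, ∀ t ∈ Icc (t₀ - T) t₀, 0 < u x t ∧ u x t ≤ D) →
        (∀ x ∈ ball x₀ R, ∀ t ∈ Icc (t₀ - T) t₀,
          deriv (fun s => u x s) t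
            = fLap f (fun y => u y t) x + a * u x t * Real.log (u x t)) →
        ∀ x ∈ ball x₀ (R / 2), ∀ t ∈ Ioc (t₀ - T) t₀,
          ‖gradient (fun y => u y t) x‖ / u x t ≤
            c * (Real.sqrt ((1 + |alphaC f x₀|) / R) + 1 / Real.sqrt (t - t₀ + T)
                  + Real.sqrt K + Real.sqrt (max (a + ((n : ℝ) - 1) * K) 0)
                  + Real.sqrt (-a * max |Real.log D| 1))
              * (1 + Real.log (D / u x t)) := by
  obtain ⟨Ψ, M, hM, hΨ, Ψ1, Ψz, Ψ0, Ψle, Ψd0, Ψd, ΨM⟩ := exists_cutoff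
  have hN : (1:ℝ) ≤ n := by exact_mod_cast hn
  refine ⟨24 * M * n, by positivity, ?_⟩
  intro f x₀ R K t₀ T a D u hf hR hK hT ha hD hess hu hbd hpde x hx
  have hxR : x ∈ ball x₀ R := ball_subset_ball (by linarith) hx
  set U : (EuclideanSpace ℝ (Fin n)) × ℝ → ℝ := fun p => u p.1 p.2 with hUdef
  set S : Set ((EuclideanSpace ℝ (Fin n)) × ℝ) := ball x₀ R ×ˢ Icc (t₀ - T) t₀ with hS
  set Ω : Set ((EuclideanSpace ℝ (Fin n)) × ℝ) := ball x₀ R ×ˢ Ioo (t₀ - T) t₀ with hΩe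
  have hΩ : IsOpen Ω := isOpen_ball.prod isOpen_Ioo
  have hΩS : Ω ⊆ S := prod_mono le_rfl Ioo_subset_Icc_self
  have hU : Sm Ω U := hu.mono hΩS
  have hpos : ∀ q ∈ Ω, 0 < U q := fun q hq => (hbd q.1 (hΩS hq).1 q.2 (hΩS hq).2).1
  have hle : ∀ q ∈ Ω, U q ≤ D := fun q hq => (hbd q.1 (hΩS hq).1 q.2 (hΩS hq).2).2
  have hFs : Sm Ω (fun q : (EuclideanSpace ℝ (Fin n)) × ℝ => f q.1) := (hf.comp contDiff_fst).contDiffOn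
  have pdeU : ∀ q ∈ Ω, dd et U q = (∑ i, dd (eb i) (dd (eb i) U) q)
      - (∑ i, dd (eb i) (fun q : (EuclideanSpace ℝ (Fin n)) × ℝ => f q.1) q * dd (eb i) U q)
      + a * U q * Real.log (U q) := by
    rintro ⟨y, r⟩ hq
    have h1 := hpde y (hΩS hq).1 r (hΩS hq).2
    have h2 : dd et U (y, r) = deriv (fun s => u y s) r := dd_time hΩ hU hq
    have h3 : ∀ i, dd (eb i) (dd (eb i) U) (y, r) =
        fderiv ℝ (fun z => fderiv ℝ (fun y => u y r) z (EuclideanSpace.single i 1)) y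
          (EuclideanSpace.single i 1) := fun i => dd_slice2 hΩ hU hq _ _
    have h4 : ∀ i, dd (eb i) U (y, r) = gradient (fun y => u y r) y i := by
      intro i; rw [grad_apply]; exact dd_slice hΩ hU hq _
    have h5 : ∀ i, dd (eb i) (fun q : (EuclideanSpace ℝ (Fin n)) × ℝ => f q.1) (y, r) = gradient f y i := by
      intro i; rw [grad_apply]; exact dd_slice hΩ hFs hq _
    rw [h2, h1, fLap, eLap, PiLp.inner_apply]
    simp_rw [h3, h4, h5]
    have h6 : ∑ i, ⟪gradient f y i, gradient (fun y => u y r) y i⟫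
        = ∑ i, gradient f y i * gradient (fun y => u y r) y i :=
      Finset.sum_congr rfl fun i _ => by simp [mul_comm]
    rw [h6]
  obtain ⟨hGs, hG0, hGd, pdeG⟩ := logPDE hΩ hU hpos hle pdeU rfl
  set G : (EuclideanSpace ℝ (Fin n)) × ℝ → ℝ := fun q => Real.log (1 + Real.log D - Real.log (U q)) with hGdef
  set κ := max |Real.log D| 1 with hκ
  have hκ0 : 0 ≤ κ := le_trans zero_le_one (le_max_right _ _)
  have hA₁ : 0 ≤ -a * κ := mul_nonneg (by linarith) hκ0
  have hb : ∀ q ∈ Ω, -(-a * κ) ≤ -(a * (1 + Real.log D)) * Real.exp (-1 * G q) := by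
    intro q hq
    have h1 : Real.exp (-1 * G q) ≤ 1 := Real.exp_le_one_iff.2 (by linarith [hG0 q hq])
    have h2 := Real.exp_pos (-1 * G q)
    have h3 : -κ ≤ 1 + Real.log D := by
      have := neg_abs_le (Real.log D)
      have := le_max_left |Real.log D| 1
      linarith
    have h4 : -κ ≤ (1 + Real.log D) * Real.exp (-1 * G q) := by nlinarith
    nlinarith
  have hess' : ∀ x ∈ ball x₀ R, ∀ v : (EuclideanSpace ℝ (Fin n)), dd v (dd v f) x ≥ -((n : ℝ) - 1) * K * ‖v‖ ^ 2 :=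
    fun x hx v => hess x hx v
  have hα := alpha_bound hf x₀
  -- the estimate at interior times
  have hint : ∀ t ∈ Ioo (t₀ - T) t₀, ‖gradient (fun y => u y t) x‖ / u x t ≤
            24 * M * n * (Real.sqrt ((1 + |alphaC f x₀|) / R) + 1 / Real.sqrt (t - t₀ + T)
                  + Real.sqrt K + Real.sqrt (max (a + ((n : ℝ) - 1) * K) 0)
                  + Real.sqrt (-a * κ))
              * (1 + Real.log (D / u x t)) := by
    intro t ht
    have hq : (x, t) ∈ Ω := ⟨hxR, ht⟩
    have hup : 0 < u x t := hpos _ hq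
    set w : (EuclideanSpace ℝ (Fin n)) × ℝ → ℝ := fun p => ∑ j, dd (eb j) G p * dd (eb j) G p with hw
    set Q := 4 * (4 * M / R ^ 2) + (4 * M / R ^ 2 +
          2 * M * (1 + R * |alphaC f x₀| + ((n : ℝ) - 1) * K * R ^ 2) / R ^ 2)
          + 2 * (((n : ℝ) - 1) * K + -a * κ) with hQ
    have hev : ∀ s ∈ Ioo (t₀ - T) t, (t - s) * w (x, t) ≤ (t - s) * Q + 1 := fun s hs =>
      interior_est hn hM hΨ Ψ1 Ψz Ψ0 Ψle Ψd0 Ψd ΨM hf hR hK hess' hα hΩe hGs hG0 hA₁ hb hw pdeG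
        hs.1 hs.2 ht.2 hx
    have hlim : (t - (t₀ - T)) * w (x, t) ≤ (t - (t₀ - T)) * Q + 1 := by
      have hcl : t₀ - T ∈ closure (Ioo (t₀ - T) t) := by
        rw [closure_Ioo ht.1.ne]; exact left_mem_Icc.2 ht.1.le
      exact ContinuousWithinAt.closure_le (f := fun s => (t - s) * w (x, t))
        (g := fun s => (t - s) * Q + 1) hcl
        (Continuous.continuousWithinAt (by fun_prop))
        (Continuous.continuousWithinAt (by fun_prop)) hev
    rw [show t - (t₀ - T) = t - t₀ + T by ring] at hlim
    have hτ : 0 < t - t₀ + T := by linarith [ht.1]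
    have hfin := final_num hN hM hR hK hA₁ hτ (Real.sqrt (max (a + ((n : ℝ) - 1) * K) 0))
      (Real.sqrt_nonneg _) hlim
    set X := Real.sqrt ((1 + |alphaC f x₀|) / R) + 1 / Real.sqrt (t - t₀ + T)
                  + Real.sqrt K + Real.sqrt (max (a + ((n : ℝ) - 1) * K) 0)
                  + Real.sqrt (-a * κ) with hX
    have hX0 : 0 ≤ X := by positivity
    have hlog : 1 + Real.log (D / u x t) = 1 + Real.log D - Real.log (u x t) := by
      rw [Real.log_div hD.ne' hup.ne']; ring
    rw [hlog]
    have hℓ1 : 1 ≤ 1 + Real.log D - Real.log (u x t) := by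
      have := Real.log_le_log hup (hle _ hq)
      linarith
    set ℓ := 1 + Real.log D - Real.log (u x t) with hℓ
    have hwe : w (x, t) = (‖gradient (fun y => u y t) x‖ / u x t / ℓ) ^ 2 := by
      rw [div_pow, div_pow, grad_norm_sq, hw]
      simp only [hGd _ hq]
      rw [Finset.sum_div, Finset.sum_div]
      refine Finset.sum_congr rfl fun i _ => ?_
      have : dd (eb i) U (x, t) = dd (EuclideanSpace.single i (1:ℝ)) (fun y => u y t) x :=
        dd_slice hΩ hU hq _
      rw [this]
      have hUx : U (x, t) = u x t := rfl
      rw [hUx, ← hℓ]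
      field_simp
    rw [hwe] at hfin
    have := abs_le_of_sq_le_sq' hfin (by positivity)
    rw [← div_le_iff₀ (by linarith)]
    exact this.2
  intro t ht
  rcases ht.2.lt_or_eq with h | h
  · exact hint t ⟨ht.1, h⟩
  -- the final time
  subst h
  have hx_t : ∀ r ∈ Icc (t - T) t, (x, r) ∈ S := fun r hr => ⟨hxR, hr⟩
  have hcl : t ∈ closure (Ioo (t - T) t) := by
    rw [closure_Ioo (by linarith [ht.1] : t - T ≠ t)]; exact right_mem_Icc.2 ht.1.le
  have htI : t ∈ Icc (t - T) t := right_mem_Icc.2 ht.1.le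
  have hmk : ContinuousOn (fun r : ℝ => (x, r)) (Icc (t - T) t) := by fun_prop
  have hcu : ContinuousOn (fun r => u x r) (Icc (t - T) t) :=
    hu.continuousOn.comp hmk hx_t
  have hcu' : ContinuousWithinAt (fun r => u x r) (Ioo (t - T) t) t :=
    (hcu t htI).mono Ioo_subset_Icc_self
  have hud : UniqueDiffOn ℝ S :=
    isOpen_ball.uniqueDiffOn.prod (uniqueDiffOn_Icc (by linarith))
  have hfd : ContinuousOn (fderivWithin ℝ U S) S :=
    hu.continuousOn_fderivWithin hud (by simp)
  have hslice : ∀ r ∈ Icc (t - T) t, fderiv ℝ (fun y => u y r) x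
      = (fderivWithin ℝ U S (x, r)).comp (ContinuousLinearMap.inl ℝ (EuclideanSpace ℝ (Fin n)) ℝ) := by
    intro r hr
    have h1 : HasFDerivWithinAt U (fderivWithin ℝ U S (x, r)) S (x, r) :=
      ((hu.differentiableOn (by simp)) _ (hx_t r hr)).hasFDerivWithinAt
    have h2 : HasFDerivWithinAt (fun y : (EuclideanSpace ℝ (Fin n)) => (y, r)) (ContinuousLinearMap.inl ℝ (EuclideanSpace ℝ (Fin n)) ℝ)
        (ball x₀ R) x := (hasFDerivAt_prodMk_left x r).hasFDerivWithinAt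
    have hmaps : MapsTo (fun y : (EuclideanSpace ℝ (Fin n)) => (y, r)) (ball x₀ R) S := fun y hy => ⟨hy, hr⟩
    have h3 := h1.comp x h2 hmaps
    exact (h3.hasFDerivAt (isOpen_ball.mem_nhds hxR)).fderiv
  have hcg : ContinuousOn (fun r => ‖gradient (fun y => u y r) x‖) (Icc (t - T) t) := by
    have h1 : ContinuousOn (fun r => ‖(fderivWithin ℝ U S (x, r)).comp
        (ContinuousLinearMap.inl ℝ (EuclideanSpace ℝ (Fin n)) ℝ)‖) (Icc (t - T) t) :=
      ((hfd.comp hmk hx_t).clm_comp continuousOn_const).norm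
    refine h1.congr fun r hr => ?_
    simp only [grad_norm, hslice r hr]
  have hcg' : ContinuousWithinAt (fun r => ‖gradient (fun y => u y r) x‖) (Ioo (t - T) t) t :=
    (hcg t htI).mono Ioo_subset_Icc_self
  have hut : 0 < u x t := (hbd x hxR t htI).1
  have hsq : ContinuousWithinAt (fun r => 1 / Real.sqrt (r - t + T)) (Ioo (t - T) t) t := by
    apply ContinuousAt.continuousWithinAt
    refine ContinuousAt.div continuousAt_const (by fun_prop) ?_
    rw [sub_self, zero_add]
    exact (Real.sqrt_pos.2 hT).ne'
  refine ContinuousWithinAt.closure_le (s := Ioo (t - T) t)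
    (f := fun r => ‖gradient (fun y => u y r) x‖ / u x r)
    (g := fun r => 24 * M * n * (Real.sqrt ((1 + |alphaC f x₀|) / R) + 1 / Real.sqrt (r - t + T)
                  + Real.sqrt K + Real.sqrt (max (a + ((n : ℝ) - 1) * K) 0)
                  + Real.sqrt (-a * κ))
              * (1 + Real.log (D / u x r))) hcl (hcg'.div hcu' hut.ne') ?_ hint
  refine ContinuousWithinAt.mul ?_ ?_
  · exact continuousWithinAt_const.mul (((((continuousWithinAt_const.add hsq).add
      continuousWithinAt_const).add continuousWithinAt_const).add continuousWithinAt_const))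
  · exact continuousWithinAt_const.add
      ((continuousWithinAt_const.div hcu' hut.ne').log (div_pos hD hut).ne')
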